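/- Let u : ℝ³ ∖ {0} → ℝ be smooth and homogeneous of degree 0. Then for every i ∈ {1,2,3}, ∫_{S²} x_i [ 2 tr( H_u(x)² ) − (Δu(x))² ] dS = ∫_{S²} x_i ( Δu(x) + 2u(x) )² dS, where Δ is the ambient Euclidean Laplacian. (This realizes the identity ∫_{S²} X̃^i [2 |∇²u|² − (Δ_{S²}u)²] = ∫_{S²} X̃^i [(Δ_{S²}+2)u]² on the round sphere.) -/

import Mathlib

open MeasureTheory Matrix

noncomputable section

/-- Euclidean 3-space. -/
abbrev E3 := EuclideanSpace ℝ (Fin 3)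

/-- The Euclidean inner product on coordinate vectors. -/
def dot3 (a b : Fin 3 → ℝ) : ℝ := ∑ i, a i * b i

/-- The cross product in ℝ³. -/
def cross3 (a b : Fin 3 → ℝ) : Fin 3 → ℝ :=
  ![a 1 * b 2 - a 2 * b 1, a 2 * b 0 - a 0 * b 2, a 0 * b 1 - a 1 * b 0]

/-- Standard basis vectors of E3. -/
def e3 (i : Fin 3) : E3 := EuclideanSpace.single i 1

/-- The ambient gradient of `u : ℝ³ → ℝ` (as a coordinate vector). -/
def grad3 (u : E3 → ℝ) (x : E3) : Fin 3 → ℝ := fun i => fderiv ℝ u x (e3 i)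

/-- The ambient Hessian matrix of `u : ℝ³ → ℝ`. -/
def hess3 (u : E3 → ℝ) (x : E3) : Matrix (Fin 3) (Fin 3) ℝ :=
  Matrix.of fun i j => iteratedFDeriv ℝ 2 u x ![e3 i, e3 j]

/-- The ambient Euclidean Laplacian Δu = Σᵢ ∂²u/∂xᵢ². -/
def lap3 (u : E3 → ℝ) : E3 → ℝ := fun x => ∑ i, hess3 u x i i

/-- The orthogonal projection P(x) = I - x xᵀ onto the tangent plane of S² at x. -/
def proj3 (x : E3) : Matrix (Fin 3) (Fin 3) ℝ := 1 - Matrix.of fun i j => x i * x j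

/-- The projected ambient Hessian H_u(x) = P(x) (D²u)(x) P(x), realizing the intrinsic
Hessian on S² of the restriction of a degree-0 homogeneous function. -/
def hessS (u : E3 → ℝ) (x : E3) : Matrix (Fin 3) (Fin 3) ℝ := proj3 x * hess3 u x * proj3 x

/-- The matrix of the linear map `w ↦ x × w` on ℝ³. -/
def crossMat (x : E3) : Matrix (Fin 3) (Fin 3) ℝ :=
  !![0, -x 2, x 1; x 2, 0, -x 0; -x 1, x 0, 0]

/-- `u` is (positively) homogeneous of degree 0 away from the origin. -/
def Homog0 (u : E3 → ℝ) : Prop := ∀ c : ℝ, 0 < c → ∀ x : E3, x ≠ 0 → u (c • x) = u x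

theorem ne_zero_of_mem_sphere_one {x : E3} (hx : x ∈ Metric.sphere (0 : E3) 1) : x ≠ 0 := by
  rintro rfl
  simp at hx

theorem sum_sq_eq_one_of_mem_sphere {x : E3} (hx : x ∈ Metric.sphere (0 : E3) 1) :
    ∑ k, x k ^ 2 = 1 := by
  have h := EuclideanSpace.norm_sq_eq x
  rw [mem_sphere_zero_iff_norm.1 hx] at h
  simpa using h.symm

/-- The unit sphere has finite two-dimensional Hausdorff measure. -/
theorem hausdorffMeasure_sphere_lt_top : μH[2] (Metric.sphere (0 : E3) 1) < ⊤ := by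
  let g : (Fin 2 → ℝ) → E3 := fun p =>
    !₂[Real.sin (p 0) * Real.cos (p 1), Real.sin (p 0) * Real.sin (p 1), Real.cos (p 0)]
  let K : Set (Fin 2 → ℝ) := Set.Icc (fun _ => -4) (fun _ => 4)
  have hg : ContDiff ℝ 1 g := by
    rw [contDiff_euclidean]
    intro i
    fin_cases i <;> simp [g] <;> fun_prop
  obtain ⟨C, hC⟩ := hg.contDiffOn.exists_lipschitzOnWith (s := K) one_ne_zero
    (convex_Icc _ _) isCompact_Icc
  have hsub : Metric.sphere (0 : E3) 1 ⊆ g '' K := by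
    intro x hx
    have hx1 : x 0 ^ 2 + x 1 ^ 2 + x 2 ^ 2 = 1 := by
      simpa only [Fin.sum_univ_three] using sum_sq_eq_one_of_mem_sphere hx
    let z : ℂ := ⟨x 0, x 1⟩
    have hz : Real.sqrt (1 - x 2 ^ 2) = ‖z‖ := by
      rw [Complex.norm_def, Complex.normSq_apply]
      congr 1
      simp only [z]
      linarith
    have h2 : -1 ≤ x 2 ∧ x 2 ≤ 1 := by constructor <;> nlinarith [sq_nonneg (x 0), sq_nonneg (x 1)]
    have hπ := Real.pi_lt_four
    refine ⟨![Real.arccos (x 2), Complex.arg z], ?_, ?_⟩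
    · constructor <;> intro i <;> fin_cases i <;> simp
      · linarith [Real.arccos_nonneg (x 2)]
      · linarith [Complex.neg_pi_lt_arg z]
      · linarith [Real.arccos_le_pi (x 2)]
      · linarith [Complex.arg_le_pi z]
    · ext i
      fin_cases i <;> simp [g, Real.sin_arccos, hz, Complex.norm_mul_cos_arg,
        Complex.norm_mul_sin_arg, Real.cos_arccos h2.1 h2.2]
      · rfl
      · rfl
  have hvol : (μH[2] : Measure (Fin 2 → ℝ)) = volume := by
    simpa using hausdorffMeasure_pi_real (ι := Fin 2)
  refine (measure_mono hsub).trans_lt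
    ((hC.hausdorffMeasure_image_le (d := 2) (by norm_num)).trans_lt ?_)
  rw [hvol]
  exact ENNReal.mul_lt_top (by simp) isCompact_Icc.measure_lt_top

/-- The surface measure on the unit sphere. -/
def sphereMeasure : Measure E3 := μH[2].restrict (Metric.sphere 0 1)

instance : IsFiniteMeasure sphereMeasure :=
  ⟨by simpa [sphereMeasure] using hausdorffMeasure_sphere_lt_top⟩

theorem integrable_sphereMeasure {f : E3 → ℝ} (hf : ContinuousOn f {0}ᶜ) :
    Integrable f sphereMeasure := by
  have hsub : Metric.sphere (0 : E3) 1 ⊆ {0}ᶜ := fun _ hx => ne_zero_of_mem_sphere_one hx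
  obtain ⟨C, hC⟩ := (isCompact_sphere (0 : E3) 1).exists_bound_of_continuousOn (hf.mono hsub)
  refine Integrable.of_bound
    ((hf.mono hsub).aestronglyMeasurable Metric.isClosed_sphere.measurableSet) C ?_
  exact (ae_restrict_iff' Metric.isClosed_sphere.measurableSet).2 (.of_forall hC)

/-- The infinitesimal rotation in the `(a, b)` coordinate plane. -/
def rotField (a b : Fin 3) (x : E3) : E3 := x a • e3 b - x b • e3 a

/-- The rotation by the angle `t` in the `(a, b)` coordinate plane. -/
def rotMap (a b : Fin 3) (t : ℝ) (x : E3) : E3 :=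
  x + (Real.cos t - 1) • (x a • e3 a + x b • e3 b) + Real.sin t • rotField a b x

theorem norm_rotMap {a b : Fin 3} (hab : a ≠ b) (t : ℝ) (x : E3) : ‖rotMap a b t x‖ = ‖x‖ := by
  have h : ‖rotMap a b t x‖ ^ 2 = ‖x‖ ^ 2 := by
    simp only [EuclideanSpace.norm_sq_eq, Fin.sum_univ_three, Real.norm_eq_abs, sq_abs]
    have hcs := Real.sin_sq_add_cos_sq t
    fin_cases a <;> fin_cases b <;> simp [rotMap, rotField, e3] at hab ⊢
    · linear_combination (x 0 ^ 2 + x 1 ^ 2) * hcs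
    · linear_combination (x 0 ^ 2 + x 2 ^ 2) * hcs
    · linear_combination (x 0 ^ 2 + x 1 ^ 2) * hcs
    · linear_combination (x 1 ^ 2 + x 2 ^ 2) * hcs
    · linear_combination (x 0 ^ 2 + x 2 ^ 2) * hcs
    · linear_combination (x 1 ^ 2 + x 2 ^ 2) * hcs
  exact (sq_eq_sq₀ (norm_nonneg _) (norm_nonneg _)).1 h

/-- The rotation by the angle `t` in the `(a, b)` coordinate plane as a linear isometry. -/
def rotEquiv {a b : Fin 3} (hab : a ≠ b) (t : ℝ) : E3 ≃ₗᵢ[ℝ] E3 :=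
  LinearIsometry.toLinearIsometryEquiv
    { toFun := rotMap a b t
      map_add' := fun x y => by
        ext i
        simp [rotMap, rotField]
        ring
      map_smul' := fun c x => by
        ext i
        simp [rotMap, rotField]
        ring
      norm_map' := norm_rotMap hab t } rfl

theorem integral_comp_rotMap {a b : Fin 3} (hab : a ≠ b) (t : ℝ) (f : E3 → ℝ) :
    ∫ x, f (rotMap a b t x) ∂sphereMeasure = ∫ x, f x ∂sphereMeasure := by
  have h := ((rotEquiv hab t).toIsometryEquiv.measurePreserving_hausdorffMeasure
    2).setIntegral_preimage_emb (rotEquiv hab t).toHomeomorph.measurableEmbedding f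
    (Metric.sphere 0 1)
  have hpre : (rotEquiv hab t).toIsometryEquiv ⁻¹' Metric.sphere (0 : E3) 1 =
      Metric.sphere 0 1 := by
    ext x
    simp
  rw [hpre] at h
  exact h

theorem hasDerivAt_rotMap (a b : Fin 3) (t : ℝ) (x : E3) :
    HasDerivAt (fun t => rotMap a b t x)
      (-Real.sin t • (x a • e3 a + x b • e3 b) + Real.cos t • rotField a b x) t := by
  unfold rotMap
  exact (((Real.hasDerivAt_cos t).sub_const 1).smul_const _ |>.const_add x).add
    ((Real.hasDerivAt_sin t).smul_const _)

/-- The derivative of a function along an infinitesimal rotation has vanishing integral. -/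
theorem integral_fderiv_rotField {a b : Fin 3} (hab : a ≠ b) {f : E3 → ℝ}
    (hf : ContDiffOn ℝ 1 f {0}ᶜ) :
    ∫ x, fderiv ℝ f x (rotField a b x) ∂sphereMeasure = 0 := by
  have hsub : Metric.sphere (0 : E3) 1 ⊆ {0}ᶜ := fun _ hx => ne_zero_of_mem_sphere_one hx
  have hdf : ContinuousOn (fderiv ℝ f) {0}ᶜ :=
    hf.continuousOn_fderiv_of_isOpen isOpen_compl_singleton le_rfl
  obtain ⟨C, hC⟩ := (isCompact_sphere (0 : E3) 1).exists_bound_of_continuousOn (hdf.mono hsub)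
  have hrot : Continuous (rotField a b) := by unfold rotField; fun_prop
  have hmem (t : ℝ) {x : E3} (hx : x ∈ Metric.sphere (0 : E3) 1) :
      rotMap a b t x ∈ Metric.sphere (0 : E3) 1 := by
    simpa [norm_rotMap hab] using hx
  have key := hasDerivAt_integral_of_dominated_loc_of_deriv_le (μ := sphereMeasure)
    (F := fun t x => f (rotMap a b t x)) (x₀ := (0 : ℝ)) (s := Set.univ)
    (F' := fun t x => fderiv ℝ f (rotMap a b t x)
      (-Real.sin t • (x a • e3 a + x b • e3 b) + Real.cos t • rotField a b x))
    (bound := fun _ => C * 4) Filter.univ_mem ?_ ?_ ?_ ?_ (integrable_const _) ?_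
  · have h0 := key.2
    simp only [integral_comp_rotMap hab] at h0
    have h1 := h0.unique (hasDerivAt_const _ _)
    simpa [rotMap] using h1
  · refine .of_forall fun t => ?_
    have hc : Continuous (rotMap a b t) := by unfold rotMap; fun_prop
    exact ((hf.continuousOn.mono hsub).comp hc.continuousOn fun x hx =>
      hmem t hx).aestronglyMeasurable Metric.isClosed_sphere.measurableSet
  · simpa [rotMap] using integrable_sphereMeasure hf.continuousOn
  · simpa [rotMap, sphereMeasure] using ((hdf.clm_apply hrot.continuousOn).mono hsub).aestronglyMeasurable
      Metric.isClosed_sphere.measurableSet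
  · refine (ae_restrict_iff' Metric.isClosed_sphere.measurableSet).2 (.of_forall ?_)
    intro x hx t _
    refine (ContinuousLinearMap.le_opNorm _ _).trans ?_
    have hxc (i : Fin 3) : |x i| ≤ 1 := by
      have h := PiLp.norm_apply_le x i
      rwa [mem_sphere_zero_iff_norm.1 hx] at h
    have he (i : Fin 3) : ‖e3 i‖ = 1 := by simp [e3]
    have hterm (i j : Fin 3) : ‖x i • e3 j‖ ≤ 1 := by
      rw [norm_smul, he, mul_one]; exact hxc i
    have h1 : ‖-Real.sin t • (x a • e3 a + x b • e3 b)‖ ≤ 1 * (1 + 1) := by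
      rw [norm_smul]
      exact mul_le_mul (by simpa using Real.abs_sin_le_one t)
        ((norm_add_le _ _).trans (add_le_add (hterm _ _) (hterm _ _))) (norm_nonneg _) zero_le_one
    have h2 : ‖Real.cos t • rotField a b x‖ ≤ 1 * (1 + 1) := by
      rw [norm_smul]
      exact mul_le_mul (by simpa using Real.abs_cos_le_one t)
        ((norm_sub_le _ _).trans (add_le_add (hterm _ _) (hterm _ _))) (norm_nonneg _) zero_le_one
    exact mul_le_mul (hC _ (hmem t hx)) ((norm_add_le _ _).trans (by linarith))
      (norm_nonneg _) ((norm_nonneg _).trans (hC _ hx))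
  · refine (ae_restrict_iff' Metric.isClosed_sphere.measurableSet).2 (.of_forall ?_)
    intro x hx t _
    exact (((hf.differentiableOn one_ne_zero).differentiableAt
      (isOpen_compl_singleton.mem_nhds (hsub (hmem t hx)))).hasFDerivAt.comp_hasDerivAt t
      (hasDerivAt_rotMap a b t x))

/-- The partial derivative of `f` in the direction of the `j`-th coordinate. -/
def pd (j : Fin 3) (f : E3 → ℝ) (x : E3) : ℝ := fderiv ℝ f x (e3 j)

theorem fderiv_eq_sum_pd (f : E3 → ℝ) (x v : E3) : fderiv ℝ f x v = ∑ k, v k * pd k f x := by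
  have hv : v = ∑ k, v k • e3 k := by
    ext i
    fin_cases i <;> simp [e3, Fin.sum_univ_three]
  conv_lhs => rw [hv]
  simp [pd]

theorem hasFDerivAt_coord (j : Fin 3) (x : E3) :
    HasFDerivAt (fun x : E3 => x j) (EuclideanSpace.proj (𝕜 := ℝ) j : E3 →L[ℝ] ℝ) x :=
  (EuclideanSpace.proj (𝕜 := ℝ) j).hasFDerivAt

/-- `f` is smooth away from the origin and satisfies Euler's relation of degree `d`. -/
structure HomSmooth (d : ℝ) (f : E3 → ℝ) : Prop where
  smooth : ContDiffOn ℝ (⊤ : ℕ∞) f {0}ᶜ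
  euler : ∀ x ≠ 0, fderiv ℝ f x x = d * f x

namespace HomSmooth

variable {d d₁ d₂ : ℝ} {f g : E3 → ℝ} {x : E3}

theorem contDiffAt (hf : HomSmooth d f) (hx : x ≠ 0) : ContDiffAt ℝ (⊤ : ℕ∞) f x :=
  hf.smooth.contDiffAt (isOpen_compl_singleton.mem_nhds hx)

theorem hasFDerivAt (hf : HomSmooth d f) (hx : x ≠ 0) : HasFDerivAt f (fderiv ℝ f x) x :=
  ((hf.contDiffAt hx).differentiableAt (by simp)).hasFDerivAt

theorem contDiffOn_fderiv (hf : HomSmooth d f) :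
    ContDiffOn ℝ (⊤ : ℕ∞) (fderiv ℝ f) {0}ᶜ :=
  hf.smooth.fderiv_of_isOpen isOpen_compl_singleton (by norm_cast)

theorem coord (j : Fin 3) : HomSmooth 1 (fun x => x j) where
  smooth := (EuclideanSpace.proj (𝕜 := ℝ) j).contDiff.contDiffOn
  euler x _ := by
    rw [(hasFDerivAt_coord j x).fderiv]
    simp

theorem const_mul (hf : HomSmooth d f) (c : ℝ) : HomSmooth d (fun x => c * f x) where
  smooth := contDiffOn_const.mul hf.smooth
  euler x hx := by
    rw [((hf.hasFDerivAt hx).const_mul c).fderiv]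
    simp [hf.euler x hx]
    ring

theorem mul (hf : HomSmooth d₁ f) (hg : HomSmooth d₂ g) (hd : d₁ + d₂ = d) :
    HomSmooth d (fun x => f x * g x) where
  smooth := hf.smooth.mul hg.smooth
  euler x hx := by
    rw [((hf.hasFDerivAt hx).fun_mul (hg.hasFDerivAt hx)).fderiv]
    simp [hf.euler x hx, hg.euler x hx, ← hd]
    ring

theorem add (hf : HomSmooth d f) (hg : HomSmooth d g) : HomSmooth d (fun x => f x + g x) where
  smooth := hf.smooth.add hg.smooth
  euler x hx := by
    rw [((hf.hasFDerivAt hx).fun_add (hg.hasFDerivAt hx)).fderiv]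
    simp [hf.euler x hx, hg.euler x hx]
    ring

theorem sub (hf : HomSmooth d f) (hg : HomSmooth d g) : HomSmooth d (fun x => f x - g x) where
  smooth := hf.smooth.sub hg.smooth
  euler x hx := by
    rw [((hf.hasFDerivAt hx).fun_sub (hg.hasFDerivAt hx)).fderiv]
    simp [hf.euler x hx, hg.euler x hx]
    ring

theorem sum {F : Fin 3 → E3 → ℝ} (hF : ∀ k, HomSmooth d (F k)) :
    HomSmooth d (fun x => ∑ k, F k x) := by
  simpa only [Fin.sum_univ_three] using ((hF 0).add (hF 1)).add (hF 2)

theorem hasFDerivAt_fderiv (hf : HomSmooth d f) (hx : x ≠ 0) :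
    HasFDerivAt (fderiv ℝ f) (fderiv ℝ (fderiv ℝ f) x) x :=
  ((hf.contDiffOn_fderiv.contDiffAt (isOpen_compl_singleton.mem_nhds hx)).differentiableAt
    (by simp)).hasFDerivAt

theorem fderiv_pd (hf : HomSmooth d f) (hx : x ≠ 0) (j : Fin 3) (v : E3) :
    fderiv ℝ (_root_.pd j f) x v = fderiv ℝ (fderiv ℝ f) x v (e3 j) := by
  have h := (hf.hasFDerivAt_fderiv hx).clm_apply (hasFDerivAt_const (e3 j) x)
  change HasFDerivAt (_root_.pd j f) _ x at h
  rw [h.fderiv]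
  simp

theorem isSymmSndFDerivAt (hf : HomSmooth d f) (hx : x ≠ 0) : IsSymmSndFDerivAt ℝ f x :=
  (hf.contDiffAt hx).isSymmSndFDerivAt (by simp; norm_cast)

theorem pd_comm (hf : HomSmooth d f) (hx : x ≠ 0) (i j : Fin 3) :
    _root_.pd i (_root_.pd j f) x = _root_.pd j (_root_.pd i f) x := by
  change fderiv ℝ (_root_.pd j f) x _ = fderiv ℝ (_root_.pd i f) x _
  rw [hf.fderiv_pd hx, hf.fderiv_pd hx]
  exact hf.isSymmSndFDerivAt hx _ _

theorem pd (hf : HomSmooth d f) (j : Fin 3) : HomSmooth (d - 1) (pd j f) where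
  smooth := hf.contDiffOn_fderiv.clm_apply contDiffOn_const
  euler x hx := by
    have h₁ := (hf.hasFDerivAt_fderiv hx).clm_apply (hasFDerivAt_id x)
    have h₂ := (hf.hasFDerivAt hx).const_mul d
    have heq : (fun y => fderiv ℝ f y (id y)) =ᶠ[nhds x] fun y => d * f y :=
      Filter.eventually_of_mem (isOpen_compl_singleton.mem_nhds hx) hf.euler
    have h := congrArg (fun L : E3 →L[ℝ] ℝ => L (e3 j))
      ((h₁.congr_of_eventuallyEq heq.symm).unique h₂)
    simp at h
    rw [hf.fderiv_pd hx, hf.isSymmSndFDerivAt hx x (e3 j)]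
    unfold _root_.pd
    linarith

end HomSmooth

theorem integral_sphereMeasure_congr {f g : E3 → ℝ}
    (h : ∀ x ∈ Metric.sphere (0 : E3) 1, f x = g x) :
    ∫ x, f x ∂sphereMeasure = ∫ x, g x ∂sphereMeasure :=
  setIntegral_congr_fun Metric.isClosed_sphere.measurableSet h

theorem integrable_pd_sub {d : ℝ} {f : E3 → ℝ} (hf : HomSmooth d f) (j : Fin 3) :
    Integrable (fun x => pd j f x - (d + 2) * (x j * f x)) sphereMeasure :=
  integrable_sphereMeasure ((hf.pd j).smooth.continuousOn.sub
    (continuousOn_const.mul (((HomSmooth.coord j).mul hf rfl).smooth.continuousOn)))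

/-- The divergence theorem on the sphere for the vector field `f • e3 j`, where `f` is homogeneous
of degree `d`. -/
theorem integral_pd_sub {d : ℝ} {f : E3 → ℝ} (hf : HomSmooth d f) (j : Fin 3) :
    ∫ x, (pd j f x - (d + 2) * (x j * f x)) ∂sphereMeasure = 0 := by
  have hF (a : Fin 3) := (HomSmooth.coord a).mul hf rfl
  have hint (a : Fin 3) :
      Integrable (fun x => fderiv ℝ (fun y : E3 => y a * f y) x (rotField a j x))
        sphereMeasure := by
    refine integrable_sphereMeasure ((hF a).contDiffOn_fderiv.continuousOn.clm_apply ?_)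
    unfold rotField
    fun_prop
  have hzero (a : Fin 3) :
      ∫ x, fderiv ℝ (fun y : E3 => y a * f y) x (rotField a j x) ∂sphereMeasure = 0 := by
    rcases eq_or_ne a j with rfl | haj
    · simp [rotField]
    · exact integral_fderiv_rotField haj ((hF a).smooth.of_le (by norm_cast))
  have hsum : ∫ x, ∑ a, fderiv ℝ (fun y : E3 => y a * f y) x (rotField a j x)
      ∂sphereMeasure = 0 := by
    rw [integral_finsetSum _ fun a _ => hint a]
    simp [hzero]
  rw [← hsum]
  refine integral_sphereMeasure_congr fun x hx => ?_
  have hx0 := ne_zero_of_mem_sphere_one hx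
  have hx1 := sum_sq_eq_one_of_mem_sphere hx
  have he := hf.euler x hx0
  rw [fderiv_eq_sum_pd] at he
  have hd (a k : Fin 3) : fderiv ℝ (fun y : E3 => y a * f y) x (e3 k) =
      x a * pd k f x + f x * (e3 k) a := by
    rw [((hasFDerivAt_coord a x).fun_mul (hf.hasFDerivAt hx0)).fderiv]
    simp [pd]
  simp only [rotField, map_sub, map_smul, hd, smul_eq_mul]
  simp only [Fin.sum_univ_three] at he hx1 ⊢
  fin_cases j <;> simp [e3]
  · linear_combination x 0 * he - pd 0 f x * hx1
  · linear_combination x 1 * he - pd 1 f x * hx1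
  · linear_combination x 2 * he - pd 2 f x * hx1

theorem Homog0.homSmooth {u : E3 → ℝ} (hu0 : Homog0 u)
    (hu : ContDiffOn ℝ (⊤ : ℕ∞) u {(0 : E3)}ᶜ) : HomSmooth 0 u where
  smooth := hu
  euler x hx := by
    have hd : HasFDerivAt u (fderiv ℝ u x) ((1 : ℝ) • x) := by
      rw [one_smul]
      exact ((hu.contDiffAt (isOpen_compl_singleton.mem_nhds hx)).differentiableAt
        (by simp)).hasFDerivAt
    have h := hd.comp_hasDerivAt (1 : ℝ) ((hasDerivAt_id (1 : ℝ)).smul_const x)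
    have heq : (fun c : ℝ => u (c • x)) =ᶠ[nhds 1] fun _ => u x :=
      Filter.eventually_of_mem (Ioi_mem_nhds one_pos) fun c hc => hu0 c hc x hx
    have h' := (h.congr_of_eventuallyEq heq.symm).unique (hasDerivAt_const _ _)
    simpa using h'

theorem HomSmooth.hess3_apply {d : ℝ} {u : E3 → ℝ} (hu : HomSmooth d u) {x : E3} (hx : x ≠ 0)
    (i j : Fin 3) : hess3 u x i j = _root_.pd i (_root_.pd j u) x := by
  simp only [hess3, Matrix.of_apply, iteratedFDeriv_two_apply]
  exact (hu.fderiv_pd hx j (e3 i)).symm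

/-- The squared norm of the projected Hessian of a function homogeneous of degree `0`. -/
theorem trace_hessS_mul_hessS {u : E3 → ℝ} (hu : HomSmooth 0 u) {x : E3}
    (hx : x ∈ Metric.sphere (0 : E3) 1) :
    (hessS u x * hessS u x).trace =
      ∑ i, ∑ j, pd i (pd j u) x ^ 2 - 2 * ∑ i, pd i u x ^ 2 := by
  have hx0 := ne_zero_of_mem_sphere_one hx
  have hx1 := sum_sq_eq_one_of_mem_sphere hx
  have hu1 := hu.euler x hx0
  have hp (k : Fin 3) := (hu.pd k).euler x hx0
  simp only [fderiv_eq_sum_pd] at hu1 hp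
  have hMM : (Matrix.of fun i j => x i * x j : Matrix (Fin 3) (Fin 3) ℝ) *
      (Matrix.of fun i j => x i * x j) = Matrix.of fun i j => x i * x j := by
    ext i j
    simp only [Matrix.mul_apply, Matrix.of_apply, Fin.sum_univ_three] at hx1 ⊢
    linear_combination x i * x j * hx1
  have hPP : proj3 x * proj3 x = proj3 x := by
    simp only [proj3, sub_mul, mul_sub, one_mul, mul_one, hMM]
    simp
  have hPD : proj3 x * hess3 u x = Matrix.of fun i j => pd i (pd j u) x + x i * pd j u x := by
    rw [proj3, sub_mul, one_mul]
    ext i j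
    simp only [Matrix.sub_apply, Matrix.mul_apply, Matrix.of_apply, hu.hess3_apply hx0,
      Fin.sum_univ_three] at hp ⊢
    linear_combination - x i * hp j
  have htr : (hessS u x * hessS u x).trace =
      ((proj3 x * hess3 u x) * (proj3 x * hess3 u x)).trace := by
    unfold hessS
    calc (proj3 x * hess3 u x * proj3 x * (proj3 x * hess3 u x * proj3 x)).trace
        = ((proj3 x * hess3 u x * (proj3 x * proj3 x) * hess3 u x) * proj3 x).trace := by
          simp only [Matrix.mul_assoc]
      _ = ((proj3 x * proj3 x) * hess3 u x * (proj3 x * hess3 u x)).trace := by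
          rw [Matrix.trace_mul_comm, hPP]
          simp only [← Matrix.mul_assoc, hPP]
      _ = _ := by rw [hPP]
  rw [htr, hPD]
  simp only [Matrix.trace, Matrix.diag, Matrix.mul_apply, Matrix.of_apply]
  have h0 := hp 0
  have h1 := hp 1
  have h2 := hp 2
  simp only [Fin.sum_univ_three] at h0 h1 h2 hu1 ⊢
  rw [hu.pd_comm hx0 1 0, hu.pd_comm hx0 2 0, hu.pd_comm hx0 2 1] at *
  linear_combination 2 * pd 0 u x * h0 + 2 * pd 1 u x * h1 + 2 * pd 2 u x * h2 +
    (x 0 * pd 0 u x + x 1 * pd 1 u x + x 2 * pd 2 u x) * hu1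

/-- Half the difference of the two integrands, in terms of ambient partial derivatives. -/
def hessianDefect (u : E3 → ℝ) (i : Fin 3) (x : E3) : ℝ :=
  x i * (∑ j, ∑ k, pd j (pd k u) x ^ 2 - 2 * ∑ k, pd k u x ^ 2 - (∑ k, pd k (pd k u) x) ^ 2
    - 2 * u x * ∑ k, pd k (pd k u) x - 2 * u x ^ 2)

/-- The defect is the spherical divergence of a vector field, so its integral vanishes. -/
theorem integral_hessianDefect {u : E3 → ℝ} (hu : HomSmooth 0 u) (i : Fin 3) :
    Integrable (hessianDefect u i) sphereMeasure ∧
      ∫ x, hessianDefect u i x ∂sphereMeasure = 0 := by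
  let A (j : Fin 3) (x : E3) : ℝ :=
    x i * (∑ k, (pd j (pd k u) x * pd k u x - pd k (pd k u) x * pd j u x))
      + pd i u x * pd j u x - e3 i j * ∑ k, pd k u x * pd k u x
  let B (j : Fin 3) (x : E3) : ℝ := e3 i j * (u x * u x) - 2 * (x i * (u x * pd j u x))
  have hp (k : Fin 3) : HomSmooth (-1) (pd k u) := by simpa using hu.pd k
  have hg (j k : Fin 3) : HomSmooth (-2) (pd j (pd k u)) := by
    have h := (hp k).pd j
    norm_num at h
    exact h
  have hA (j : Fin 3) : HomSmooth (-2) (A j) :=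
    (((HomSmooth.coord i).mul (HomSmooth.sum fun k => ((hg j k).mul (hp k) rfl).sub
      ((hg k k).mul (hp j) rfl)) (by norm_num)).add ((hp i).mul (hp j) (by norm_num))).sub
      ((HomSmooth.sum fun k => (hp k).mul (hp k) (by norm_num)).const_mul _)
  have hB (j : Fin 3) : HomSmooth 0 (B j) :=
    ((hu.mul hu (by norm_num)).const_mul _).sub
      (((HomSmooth.coord i).mul (hu.mul (hp j) rfl) (by norm_num)).const_mul 2)
  have hint : Integrable (fun x => ∑ j, ((pd j (A j) x - (-2 + 2) * (x j * A j x)) +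
      (pd j (B j) x - (0 + 2) * (x j * B j x)))) sphereMeasure :=
    integrable_finsetSum _ fun j _ => (integrable_pd_sub (hA j) j).fun_add (integrable_pd_sub (hB j) j)
  have hzero : ∫ x, ∑ j, ((pd j (A j) x - (-2 + 2) * (x j * A j x)) +
      (pd j (B j) x - (0 + 2) * (x j * B j x))) ∂sphereMeasure = 0 := by
    rw [integral_finsetSum _ fun j _ =>
      (integrable_pd_sub (hA j) j).fun_add (integrable_pd_sub (hB j) j)]
    refine Finset.sum_eq_zero fun j _ => ?_
    rw [integral_add (integrable_pd_sub (hA j) j) (integrable_pd_sub (hB j) j),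
      integral_pd_sub (hA j), integral_pd_sub (hB j), add_zero]
  have heq : ∀ x ∈ Metric.sphere (0 : E3) 1, ∑ j, ((pd j (A j) x - (-2 + 2) * (x j * A j x)) +
      (pd j (B j) x - (0 + 2) * (x j * B j x))) = hessianDefect u i x := by
    intro x hx
    have hx0 := ne_zero_of_mem_sphere_one hx
    have hu1 := hu.euler x hx0
    rw [fderiv_eq_sum_pd] at hu1
    have hdA (j : Fin 3) : pd j (A j) x =
        e3 j i * (∑ k, (pd j (pd k u) x * pd k u x - pd k (pd k u) x * pd j u x)) +
        x i * (∑ k, (pd j (pd j (pd k u)) x * pd k u x + pd j (pd k u) x * pd j (pd k u) x -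
          pd j (pd k (pd k u)) x * pd j u x - pd k (pd k u) x * pd j (pd j u) x)) +
        pd j (pd i u) x * pd j u x + pd i u x * pd j (pd j u) x -
        2 * e3 i j * ∑ k, pd k u x * pd j (pd k u) x := by
      have h : HasFDerivAt (A j) _ x :=
        (((hasFDerivAt_coord i x).fun_mul (HasFDerivAt.fun_sum fun k (_ : k ∈ Finset.univ) =>
          (((hg j k).hasFDerivAt hx0).fun_mul ((hp k).hasFDerivAt hx0)).fun_sub
          (((hg k k).hasFDerivAt hx0).fun_mul ((hp j).hasFDerivAt hx0)))).fun_add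
          (((hp i).hasFDerivAt hx0).fun_mul ((hp j).hasFDerivAt hx0))).fun_sub
          ((HasFDerivAt.fun_sum fun k (_ : k ∈ Finset.univ) =>
            ((hp k).hasFDerivAt hx0).fun_mul ((hp k).hasFDerivAt hx0)).const_mul _)
      unfold pd at h ⊢
      rw [h.fderiv]
      simp [Fin.sum_univ_three]
      ring
    have hdB (j : Fin 3) : pd j (B j) x = e3 i j * (2 * u x * pd j u x) -
        2 * (e3 j i * (u x * pd j u x) + x i * (pd j u x * pd j u x + u x * pd j (pd j u) x)) := by
      have h : HasFDerivAt (B j) _ x :=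
        (((hu.hasFDerivAt hx0).fun_mul (hu.hasFDerivAt hx0)).const_mul _).fun_sub
          (((hasFDerivAt_coord i x).fun_mul ((hu.hasFDerivAt hx0).fun_mul
            ((hp j).hasFDerivAt hx0))).const_mul 2)
      unfold pd at h ⊢
      rw [h.fderiv]
      simp
      ring
    have hcomm (j k : Fin 3) : pd j (pd k u) =ᶠ[nhds x] pd k (pd j u) :=
      Filter.eventually_of_mem (isOpen_compl_singleton.mem_nhds hx0) fun y hy =>
        hu.pd_comm hy j k
    have hthird (j k : Fin 3) : pd j (pd j (pd k u)) x = pd k (pd j (pd j u)) x := by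
      have h : pd j (pd j (pd k u)) x = pd j (pd k (pd j u)) x := by
        change fderiv ℝ (pd j (pd k u)) x _ = fderiv ℝ (pd k (pd j u)) x _
        rw [(hcomm j k).fderiv_eq]
      rw [h, (hp j).pd_comm hx0]
    simp only [hdA, hdB, hessianDefect, A, B]
    simp only [Fin.sum_univ_three] at hu1 ⊢
    rw [hu.pd_comm hx0 1 0, hu.pd_comm hx0 2 0, hu.pd_comm hx0 2 1, hthird 0 1, hthird 0 2,
      hthird 1 0, hthird 1 2, hthird 2 0, hthird 2 1]
    fin_cases i <;> simp [e3]
    · rw [hu.pd_comm hx0 1 0, hu.pd_comm hx0 2 0]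
      linear_combination 4 * x 0 * u x * hu1
    · rw [hu.pd_comm hx0 2 1]
      linear_combination 4 * x 1 * u x * hu1
    · linear_combination 4 * x 2 * u x * hu1
  exact ⟨hint.congr ((ae_restrict_iff' Metric.isClosed_sphere.measurableSet).2 (.of_forall heq)),
    (integral_sphereMeasure_congr heq).symm.trans hzero⟩

/-- for smooth degree-0 homogeneous u on ℝ³∖{0} and each i,
∫_{S²} x_i [2 tr(H_u²) − (Δu)²] dS = ∫_{S²} x_i (Δu + 2u)² dS. -/
theorem integral_coord_hessian_square (u : E3 → ℝ)
    (hu : ContDiffOn ℝ (⊤ : ℕ∞) u {(0:E3)}ᶜ) (hu0 : Homog0 u) (i : Fin 3) :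
    ∫ x in Metric.sphere (0:E3) 1,
        x i * (2 * (hessS u x * hessS u x).trace - (lap3 u x) ^ 2) ∂(μH[2]) =
    ∫ x in Metric.sphere (0:E3) 1, x i * (lap3 u x + 2 * u x) ^ 2 ∂(μH[2]) := by
  have hu' : HomSmooth 0 u := hu0.homSmooth hu
  have hτ : ContinuousOn (fun x => lap3 u x) {0}ᶜ := by
    have h : ContinuousOn (fun x => ∑ k, pd k (pd k u) x) {0}ᶜ :=
      (HomSmooth.sum fun k => (hu'.pd k).pd k).smooth.continuousOn
    refine h.congr fun x hx => ?_
    simp only [lap3, hu'.hess3_apply hx]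
  have hR : Integrable (fun x : E3 => x i * (lap3 u x + 2 * u x) ^ 2) sphereMeasure :=
    integrable_sphereMeasure ((HomSmooth.coord i).smooth.continuousOn.mul
      ((hτ.add (continuousOn_const.mul hu.continuousOn)).pow 2))
  have hQ := integral_hessianDefect hu' i
  change ∫ x, _ ∂sphereMeasure = ∫ x, _ ∂sphereMeasure
  calc ∫ x : E3, x i * (2 * (hessS u x * hessS u x).trace - (lap3 u x) ^ 2) ∂sphereMeasure
      = ∫ x : E3, (x i * (lap3 u x + 2 * u x) ^ 2 + 2 * hessianDefect u i x) ∂sphereMeasure := by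
        refine integral_sphereMeasure_congr fun x hx => ?_
        rw [trace_hessS_mul_hessS hu' hx]
        simp only [lap3, hu'.hess3_apply (ne_zero_of_mem_sphere_one hx), hessianDefect]
        ring
    _ = _ := by
        rw [integral_add hR (hQ.1.const_mul 2), integral_const_mul, hQ.2]
        simp
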